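/- arXiv:math/0610791 — 3 statements merged into one kernel-verified Lean document; each statement's English description precedes it below -/
import Mathlib

section
/- Let s₂(n) denote the sum of the binary digits of the natural number n, let j := exp(2πi/3) ∈ ℂ, and define u : ℕ → ℂ by u(n) := (-1)^{s₂(n)} · j^n. Then for every natural number N, ∑_{k < 4N} u(k) = 3 · ∑_{k < N} u(k). -/
/-- Sum of the binary digits of `n`. -/
def s2 (n : ℕ) : ℕ := (Nat.digits 2 n).sum

/-- The primitive cube root of unity `j = exp(2πi/3)`. -/
noncomputable def jc : ℂ := Complex.exp (2 * Real.pi * Complex.I / 3)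

/-- The sequence `u n = (-1)^{s₂(n)} j^n`. -/
noncomputable def u (n : ℕ) : ℂ := (-1) ^ s2 n * jc ^ n

theorem s2_even (n : ℕ) : s2 (2 * n) = s2 n := by
  unfold s2
  rcases Nat.eq_zero_or_pos n with h | h
  · simp [h]
  · rw [Nat.digits_def' (by norm_num) (by omega)]
    simp

theorem s2_odd (n : ℕ) : s2 (2 * n + 1) = 1 + s2 n := by
  unfold s2
  rw [Nat.digits_def' (by norm_num) (by omega)]
  have h1 : (2 * n + 1) % 2 = 1 := by omega
  have h2 : (2 * n + 1) / 2 = n := by omega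
  rw [h1, h2]
  simp

theorem jc_prim : IsPrimitiveRoot jc 3 := by
  have h := Complex.isPrimitiveRoot_exp 3 (by norm_num)
  unfold jc
  exact_mod_cast h

theorem jc_sum : 1 + jc + jc ^ 2 = 0 := by
  have h := jc_prim.geom_sum_eq_zero (by norm_num)
  simpa [Finset.sum_range_succ] using h

theorem jc_cube : jc ^ 3 = 1 := jc_prim.pow_eq_one

theorem u_block (n : ℕ) :
    u (4 * n) + u (4 * n + 1) + u (4 * n + 2) + u (4 * n + 3) = 3 * u n := by
  have e0 : s2 (4 * n) = s2 n := by
    rw [show 4 * n = 2 * (2 * n) by ring, s2_even, s2_even]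
  have e1 : s2 (4 * n + 1) = 1 + s2 n := by
    rw [show 4 * n + 1 = 2 * (2 * n) + 1 by ring, s2_odd, s2_even]
  have e2 : s2 (4 * n + 2) = 1 + s2 n := by
    rw [show 4 * n + 2 = 2 * (2 * n + 1) by ring, s2_even, s2_odd]
  have e3 : s2 (4 * n + 3) = 1 + (1 + s2 n) := by
    rw [show 4 * n + 3 = 2 * (2 * n + 1) + 1 by ring, s2_odd, s2_odd]
  have h4 : jc ^ (4 * n) = jc ^ n := by
    rw [pow_mul, show jc ^ 4 = jc by rw [pow_succ, jc_cube, one_mul]]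
  simp only [u, e0, e1, e2, e3, pow_add, h4, jc_cube]
  linear_combination (-(-1 : ℂ) ^ s2 n * jc ^ n) * jc_sum

theorem stmt_2 (N : ℕ) :
    ∑ k ∈ Finset.range (4 * N), u k = 3 * ∑ k ∈ Finset.range N, u k := by
  induction N with
  | zero => simp
  | succ n ih =>
    rw [show 4 * (n + 1) = 4 * n + 1 + 1 + 1 + 1 by ring]
    simp only [Finset.sum_range_succ, ih]
    linear_combination u_block n
end

section
/- Let q ≥ 3 be an odd natural number, let η := exp(2πi/q) ∈ ℂ, let Q := 2^{φ(q)} where φ is Euler's totient function, let s₂(n) denote the sum of the binary digits of n, and define v : ℕ → ℂ by v(n) := (-1)^{s₂(n)} · η^n. Then for every natural number N, ∑_{k < Q·N} v(k) = (∑_{r < Q} (-1)^{s₂(r)} η^r) · ∑_{k < N} v(k). -/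
theorem s2_step (n : ℕ) : s2 n = n % 2 + s2 (n / 2) := by
  rcases Nat.eq_zero_or_pos n with h | h
  · subst h; simp [s2]
  · unfold s2
    rw [Nat.digits_def' (by norm_num) h]
    simp

theorem s2_add (t : ℕ) : ∀ n r : ℕ, r < 2 ^ t → s2 (2 ^ t * n + r) = s2 n + s2 r := by
  induction t with
  | zero =>
    intro n r hr
    have : r = 0 := by simpa using hr
    subst this
    simp [s2]
  | succ t ih =>
    intro n r hr
    have h1 : 2 ^ (t + 1) * n + r = 2 * (2 ^ t * n) + r := by ring
    have h2 : r / 2 < 2 ^ t := by rw [pow_succ] at hr; omega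
    have h3 : (2 * (2 ^ t * n) + r) / 2 = 2 ^ t * n + r / 2 := by omega
    have h4 : (2 * (2 ^ t * n) + r) % 2 = r % 2 := by omega
    rw [h1, s2_step, h3, h4, ih n _ h2, s2_step r]
    omega

theorem stmt_10 (q : ℕ) (hq3 : 3 ≤ q) (hq : Odd q)
    (η : ℂ) (hη : η = Complex.exp (2 * Real.pi * Complex.I / q))
    (Q : ℕ) (hQ : Q = 2 ^ Nat.totient q)
    (v : ℕ → ℂ) (hv : ∀ n, v n = (-1) ^ s2 n * η ^ n)
    (N : ℕ) :
    ∑ k ∈ Finset.range (Q * N), v k =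
      (∑ r ∈ Finset.range Q, (-1) ^ s2 r * η ^ r) *
        ∑ k ∈ Finset.range N, v k := by
  have hroot : η ^ q = 1 := by
    rw [hη]
    exact (Complex.isPrimitiveRoot_exp q (by omega)).pow_eq_one
  have hmod : Q ≡ 1 [MOD q] := by
    rw [hQ]
    exact Nat.ModEq.pow_totient (Nat.coprime_two_left.mpr hq)
  have hηQ : η ^ Q = η := by
    rw [pow_eq_pow_mod Q hroot, hmod, ← pow_eq_pow_mod 1 hroot, pow_one]
  induction N with
  | zero => simp
  | succ N ih =>
    rw [Nat.mul_succ, Finset.sum_range_add, ih, Finset.sum_range_succ, mul_add, Finset.sum_mul _ _ (v N)]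
    congr 1
    refine Finset.sum_congr rfl fun r hr => ?_
    have hr' : r < 2 ^ Nat.totient q := by rw [← hQ]; exact Finset.mem_range.mp hr
    have hs : s2 (Q * N + r) = s2 N + s2 r := by rw [hQ]; exact s2_add _ _ _ hr'
    rw [hv, hv, hs, pow_add, pow_add, pow_mul, hηQ]
    ring
end

section
/- Let ψ be the 3-uniform morphism on the alphabet {0,1} defined by ψ(0) = 000 and ψ(1) = 101, extended to words by concatenation. Then for every natural number k, the word ψ^k(1) has length 3^k, and for every n < 3^k, the n-th letter of ψ^k(1) equals 1 if every digit of the base-3 expansion of n is different from 1, and equals 0 otherwise. -/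
/-- The Cantor substitution `ψ(0) = 000`, `ψ(1) = 101` on letters. -/
def psi : Fin 2 → List (Fin 2)
  | 0 => [0, 0, 0]
  | 1 => [1, 0, 1]

/-- The extension of `ψ` to words, by concatenation. -/
def psiW (v : List (Fin 2)) : List (Fin 2) := (v.map psi).flatten

theorem psiW_length (v : List (Fin 2)) : (psiW v).length = 3 * v.length := by
  induction v with
  | nil => rfl
  | cons a v ih =>
    have : psiW (a :: v) = psi a ++ psiW v := by simp [psiW]
    rw [this, List.length_append, ih, List.length_cons]
    fin_cases a <;> simp [psi] <;> omega

theorem psiW_getD (v : List (Fin 2)) : ∀ n, (psiW v).getD n 0 =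
    if n % 3 = 1 then 0 else v.getD (n / 3) 0 := by
  induction v with
  | nil => intro n; simp [psiW]
  | cons a v ih =>
    intro n
    have h : psiW (a :: v) = psi a ++ psiW v := by simp [psiW]
    rw [h]
    match n with
    | 0 => fin_cases a <;> simp [psi]
    | 1 => fin_cases a <;> simp [psi]
    | 2 => fin_cases a <;> simp [psi]
    | n + 3 =>
      have e : (psi a ++ psiW v).getD (n + 3) 0 = (psiW v).getD n 0 := by
        fin_cases a <;> simp [psi]
      rw [e, ih n, Nat.add_mod_right, Nat.add_div_right n (by norm_num : 0 < 3),
        List.getD_cons_succ]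

theorem stmt_15 (k : ℕ) :
    (psiW^[k] [1]).length = 3 ^ k ∧
    ∀ n, n < 3 ^ k →
      (psiW^[k] [1]).getD n 0 =
        (if ∀ d ∈ Nat.digits 3 n, d ≠ 1 then 1 else 0) := by
  induction k with
  | zero =>
    refine ⟨rfl, ?_⟩
    intro n hn
    obtain rfl : n = 0 := by simpa using hn
    simp
  | succ k ih =>
    obtain ⟨h1, h2⟩ := ih
    rw [Function.iterate_succ_apply']
    refine ⟨by rw [psiW_length, h1, pow_succ, mul_comm], ?_⟩
    intro n hn
    rw [psiW_getD, h2 (n / 3) (by rw [pow_succ] at hn; omega)]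
    rcases Nat.eq_zero_or_pos n with rfl | hp
    · simp
    · rw [Nat.digits_def' (by norm_num : 1 < 3) hp]
      simp only [List.forall_mem_cons]
      by_cases h : n % 3 = 1 <;> simp [h]
end
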